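/- arXiv:0906.3220 — 4 statements merged into one kernel-verified Lean document; each statement's English description precedes it below -/
import Mathlib

section
/- Let Σ be an alphabet, let # be a symbol not in Σ, let k ≥ 1, and let L_1, L_2, …, L_k be languages over Σ. A word u belonging to the concatenation L_1·{#}·L_2·{#}·…·L_k·{#} is a k-power if and only if there exists a word z in the intersection L_1 ∩ L_2 ∩ … ∩ L_k such that u = (z#)^k. In particular, the concatenation L_1·{#}·L_2·{#}·…·L_k·{#} contains a k-power if and only if L_1 ∩ L_2 ∩ … ∩ L_k is nonempty. -/
/-- `wordPow v k` is the word `v` concatenated with itself `k` times, i.e. `v ^ k`. -/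
def wordPow {α : Type*} (v : List α) (k : ℕ) : List α :=
  (List.replicate k v).flatten

theorem wordPow_succ' {α : Type*} (v : List α) (k : ℕ) :
    wordPow v (k + 1) = wordPow v k ++ v := by
  simp [wordPow, List.replicate_succ']

theorem Language.mem_prod_ofFn {α : Type*} {k : ℕ} (M : Fin k → Language α) (u : List α) :
    u ∈ (List.ofFn M).prod ↔ ∃ x : Fin k → List α, (∀ i, x i ∈ M i) ∧ u = (List.ofFn x).flatten := by
  induction k generalizing u with
  | zero => simp [Language.mem_one]
  | succ k ih =>
    rw [List.ofFn_succ, List.prod_cons, Language.mem_mul]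
    constructor
    · rintro ⟨a, ha, b, hb, rfl⟩
      obtain ⟨x, hx, rfl⟩ := (ih _ _).1 hb
      exact ⟨Fin.cons a x, Fin.cases ha hx, by simp [List.ofFn_succ]⟩
    · rintro ⟨x, hx, rfl⟩
      exact ⟨x 0, hx 0, _, (ih _ _).2 ⟨fun i => x i.succ, fun i => hx _, rfl⟩,
        by simp [List.ofFn_succ]⟩

theorem Language.mem_prod_ofFn_mul_singleton {α : Type*} {k : ℕ} (L : Fin k → Language α)
    (w u : List α) :
    u ∈ (List.ofFn fun i : Fin k => L i * ({w} : Language α)).prod ↔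
      ∃ x : Fin k → List α, (∀ i, x i ∈ L i) ∧ u = (List.ofFn fun i => x i ++ w).flatten := by
  rw [Language.mem_prod_ofFn]
  constructor
  · rintro ⟨y, hy, rfl⟩
    have h : ∀ i, ∃ a ∈ L i, a ++ w = y i := fun i => by
      obtain ⟨a, ha, b, hb, hab⟩ := Language.mem_mul.1 (hy i)
      obtain rfl : b = w := hb
      exact ⟨a, ha, hab⟩
    choose x hx hxy using h
    exact ⟨x, hx, by simp only [hxy]⟩
  · rintro ⟨x, hx, rfl⟩
    exact ⟨_, fun i => Language.mem_mul.2 ⟨x i, hx i, w, rfl, rfl⟩, rfl⟩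

theorem List.append_cons_inj_of_notMem_left {α : Type*} {c : α} {a b s t : List α}
    (ha : c ∉ a) (hb : c ∉ b) (h : a ++ c :: s = b ++ c :: t) : a = b ∧ s = t := by
  induction a generalizing b with
  | nil =>
    cases b with
    | nil => exact ⟨rfl, (List.cons.inj h).2⟩
    | cons e b => exact absurd (List.mem_cons.2 (.inl (List.cons.inj h).1)) hb
  | cons d a ih =>
    cases b with
    | nil => exact absurd (List.mem_cons.2 (.inl (List.cons.inj h).1.symm)) ha
    | cons e b =>
      simp only [List.cons_append, List.cons.injEq, List.mem_cons, not_or] at *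
      obtain ⟨h₁, h₂⟩ := ih ha.2 hb.2 h.2
      exact ⟨⟨h.1, h₁⟩, h₂⟩

theorem eq_of_flatten_ofFn_append_singleton_eq_wordPow {α : Type*} {c : α} {k : ℕ}
    {x : Fin k → List α} {z : List α} (hx : ∀ i, c ∉ x i) (hz : c ∉ z)
    (h : (List.ofFn fun i => x i ++ [c]).flatten = wordPow (z ++ [c]) k) (i : Fin k) :
    x i = z := by
  induction k with
  | zero => exact i.elim0
  | succ k ih =>
    simp only [wordPow, List.ofFn_succ, List.replicate_succ, List.flatten_cons, List.append_assoc,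
      List.singleton_append] at h
    obtain ⟨h₁, h₂⟩ := List.append_cons_inj_of_notMem_left (hx 0) hz h
    exact Fin.cases h₁ (ih (fun i => hx _) h₂) i

theorem count_flatten_ofFn_append_singleton {α : Type*} [DecidableEq α] {c : α} {k : ℕ}
    {x : Fin k → List α} (hx : ∀ i, c ∉ x i) :
    (List.ofFn fun i => x i ++ [c]).flatten.count c = k := by
  induction k with
  | zero => simp
  | succ k ih =>
    rw [List.ofFn_succ, List.flatten_cons, List.count_append, ih fun i => hx _]
    simp [List.count_eq_zero_of_not_mem (hx 0), add_comm]

theorem exists_eq_append_singleton_of_flatten_ofFn_eq_wordPow {α : Type*} {c : α} {k : ℕ}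
    (hk : 1 ≤ k) {x : Fin k → List α} (hx : ∀ i, c ∉ x i) {v : List α} (hv : v ≠ [])
    (h : (List.ofFn fun i => x i ++ [c]).flatten = wordPow v k) :
    ∃ z, c ∉ z ∧ v = z ++ [c] := by
  classical
  obtain ⟨k, rfl⟩ := Nat.exists_eq_add_of_le' hk
  have hcount := count_flatten_ofFn_append_singleton hx
  obtain ⟨z, d, rfl⟩ := (List.eq_nil_or_concat v).resolve_left hv
  rw [List.concat_eq_append] at *
  rw [h, wordPow, List.count_flatten, List.map_replicate, List.sum_replicate, smul_eq_mul] at hcount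
  have hone : (z ++ [d]).count c = 1 := Nat.eq_of_mul_eq_mul_left hk (by rw [hcount, mul_one])
  rw [wordPow_succ', List.ofFn_succ_last, List.flatten_append, List.flatten_singleton,
    ← List.append_assoc, ← List.append_assoc] at h
  obtain rfl : c = d := by simpa using (List.append_inj' h rfl).2
  refine ⟨z, ?_, rfl⟩
  rw [← List.count_eq_zero]
  simpa using hone

/-- Let `#` be a symbol not occurring in any word of the languages `L 0, …, L (k-1)`.
A word `u` of the concatenation `L 0 · {#} · L 1 · {#} · ⋯ · L (k-1) · {#}` is a
`k`-power iff `u = (z#)^k` for some `z` in the intersection of the `L i`; in particular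
the concatenation contains a `k`-power iff the intersection is nonempty. -/
theorem kpower_in_marked_concatenation {α : Type*} (hash : α) (k : ℕ) (hk : 1 ≤ k)
    (L : Fin k → Language α) (hhash : ∀ i, ∀ w ∈ L i, hash ∉ w) :
    (∀ u ∈ (List.ofFn fun i : Fin k => L i * ({[hash]} : Language α)).prod,
        ((∃ v, v ≠ [] ∧ u = wordPow v k) ↔
          ∃ z, (∀ i : Fin k, z ∈ L i) ∧ u = wordPow (z ++ [hash]) k)) ∧
    ((∃ u ∈ (List.ofFn fun i : Fin k => L i * ({[hash]} : Language α)).prod,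
        ∃ v, v ≠ [] ∧ u = wordPow v k) ↔ ∃ z, ∀ i : Fin k, z ∈ L i) := by
  have key : ∀ u ∈ (List.ofFn fun i : Fin k => L i * ({[hash]} : Language α)).prod,
      ((∃ v, v ≠ [] ∧ u = wordPow v k) ↔
        ∃ z, (∀ i : Fin k, z ∈ L i) ∧ u = wordPow (z ++ [hash]) k) := by
    intro u hu
    obtain ⟨x, hx, rfl⟩ := (Language.mem_prod_ofFn_mul_singleton L [hash] u).1 hu
    have hxc : ∀ i, hash ∉ x i := fun i => hhash i _ (hx i)
    constructor
    · rintro ⟨v, hv, h⟩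
      obtain ⟨z, hz, rfl⟩ := exists_eq_append_singleton_of_flatten_ofFn_eq_wordPow hk hxc hv h
      exact ⟨z, fun i => eq_of_flatten_ofFn_append_singleton_eq_wordPow hxc hz h i ▸ hx i, h⟩
    · rintro ⟨z, -, h⟩
      exact ⟨z ++ [hash], by simp, h⟩
  refine ⟨key, ?_, ?_⟩
  · rintro ⟨u, hu, hv⟩
    obtain ⟨z, hz, -⟩ := (key u hu).1 hv
    exact ⟨z, hz⟩
  · rintro ⟨z, hz⟩
    exact ⟨wordPow (z ++ [hash]) k, (Language.mem_prod_ofFn_mul_singleton L [hash] _).2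
      ⟨fun _ => z, hz, by simp [wordPow, List.ofFn_const]⟩, z ++ [hash], by simp, rfl⟩
end

section
/- Let φ be a Boolean formula in 3-CNF with variables V_1, …, V_n and clauses C_1, …, C_m. Then there exist deterministic finite automata A_1, …, A_m over the alphabet {0,1}, each with at most 2n+1 states and each accepting a finite language (a subset of the words of length n), such that the intersection L(A_1) ∩ L(A_2) ∩ … ∩ L(A_m) is nonempty if and only if φ is satisfiable. -/
/-- The automaton over `Bool` accepting the words `w` of length `n` having a position `i` with
`sat i w[i]`. The state `some (i, b)` means that `i` letters have been read and `b` records whether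
a good position has been seen; as `(0, true)` is unreachable in this reading, `some (0, true)` is
used as the accepting state. The state `none` is dead. -/
def positionDFA (n : ℕ) [NeZero n] (sat : ℕ → Bool → Bool) : DFA Bool (Option (Fin n × Bool)) where
  step
    | none, _ => none
    | some (i, b), x =>
      if i = 0 ∧ b = true then none
      else if h : i.val + 1 < n then some (⟨i.val + 1, h⟩, b || sat i x)
      else if b || sat i x then some (0, true)
      else none
  start := some (0, false)
  accept := {some (0, true)}

namespace positionDFA

variable {n : ℕ} [NeZero n] {sat : ℕ → Bool → Bool}

theorem evalFrom_none (w : List Bool) : (positionDFA n sat).evalFrom none w = none := by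
  induction w with
  | nil => rfl
  | cons x w ih => exact ih

theorem evalFrom_accept_iff (w : List Bool) :
    (positionDFA n sat).evalFrom (some (0, true)) w = some (0, true) ↔ w = [] := by
  cases w with
  | nil => simp
  | cons x w =>
    have h : (positionDFA n sat).step (some (0, true)) x = none := by simp [positionDFA]
    simp [DFA.evalFrom_cons, h, evalFrom_none]

theorem evalFrom_eq_accept_iff (w : List Bool) (i : Fin n) (b : Bool)
    (hib : ¬(i = 0 ∧ b = true)) :
    (positionDFA n sat).evalFrom (some (i, b)) w = some (0, true) ↔
      i.val + w.length = n ∧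
        (b = true ∨ ∃ k x, w[k]? = some x ∧ sat (i.val + k) x = true) := by
  induction w generalizing i b with
  | nil =>
    have := i.isLt
    simp only [DFA.evalFrom_nil, Option.some.injEq, Prod.mk.injEq, List.length_nil]
    exact ⟨fun h => absurd h hib, fun h => by omega⟩
  | cons x w ih =>
    have hex : (∃ k y, (x :: w)[k]? = some y ∧ sat (i.val + k) y = true) ↔
        sat i x = true ∨ ∃ k y, w[k]? = some y ∧ sat (i.val + 1 + k) y = true := by
      constructor
      · rintro ⟨_ | k, y, hy, hs⟩
        · simp only [List.getElem?_cons_zero, Option.some.injEq] at hy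
          subst hy
          exact Or.inl hs
        · exact Or.inr ⟨k, y, by simpa using hy, by rwa [add_right_comm, add_assoc]⟩
      · rintro (hs | ⟨k, y, hy, hs⟩)
        · exact ⟨0, x, rfl, hs⟩
        · exact ⟨k + 1, y, by simpa using hy, by rwa [add_right_comm, add_assoc] at hs⟩
    rw [DFA.evalFrom_cons, hex, List.length_cons]
    by_cases h : i.val + 1 < n
    · have hstep : (positionDFA n sat).step (some (i, b)) x =
          some (⟨i.val + 1, h⟩, b || sat i x) := by
        simp only [positionDFA, if_neg hib, dif_pos h]
      rw [hstep, ih _ _ fun h0 => Nat.succ_ne_zero _ (congrArg Fin.val h0.1)]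
      simp only [Bool.or_eq_true, or_assoc, add_right_comm, ← add_assoc]
    · have hi : i.val + 1 = n := by omega
      have hstep : (positionDFA n sat).step (some (i, b)) x =
          if b || sat i x then some (0, true) else none := by
        simp only [positionDFA, if_neg hib, dif_neg h]
      have hlen : i.val + (w.length + 1) = n ↔ w = [] := by
        rw [← List.length_eq_zero_iff]
        omega
      rw [hstep, hlen]
      split_ifs with hb
      · rw [evalFrom_accept_iff]
        rw [Bool.or_eq_true] at hb
        tauto
      · rw [evalFrom_none]
        simp only [Bool.or_eq_true, not_or] at hb
        simp only [reduceCtorEq, false_iff]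
        rintro ⟨rfl, hw⟩
        simp_all

theorem mem_accepts_iff (w : List Bool) :
    w ∈ (positionDFA n sat).accepts ↔
      w.length = n ∧ ∃ k x, w[k]? = some x ∧ sat k x = true := by
  have h := evalFrom_eq_accept_iff (sat := sat) w (0 : Fin n) false (by simp)
  simp only [Fin.val_zero, zero_add, Bool.false_eq_true, false_or] at h
  exact h

end positionDFA


/-- For a 3-CNF formula with `n` variables and `m` clauses (clause `j` consists of the
three literals `C j 0, C j 1, C j 2`, a literal being a pair of a variable index and a
polarity), there are DFAs `A j` over `{0,1}` (here `Bool`), each with at most `2n+1`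
states and each accepting only words of length `n` (hence a finite language), such that
the intersection of their languages is nonempty iff the formula is satisfiable. -/
theorem threeSat_to_finite_dfa_intersection (n m : ℕ)
    (C : Fin m → Fin 3 → Fin n × Bool) :
    ∃ (Q : Fin m → Type) (F : ∀ j, Fintype (Q j)) (A : ∀ j, DFA Bool (Q j)),
      (∀ j, @Fintype.card (Q j) (F j) ≤ 2 * n + 1) ∧
      (∀ j, ∀ w ∈ (A j).accepts, w.length = n) ∧
      (∀ j, Set.Finite ((A j).accepts : Set (List Bool))) ∧
      ((⋂ j, ((A j).accepts : Set (List Bool))).Nonempty ↔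
        ∃ σ : Fin n → Bool, ∀ j, ∃ k : Fin 3, σ (C j k).1 = (C j k).2) := by
  rcases Nat.eq_zero_or_pos n with rfl | hn
  · have : IsEmpty (Fin m) := ⟨fun j => (C j 0).1.elim0⟩
    refine ⟨isEmptyElim, isEmptyElim, isEmptyElim, isEmptyElim, isEmptyElim, isEmptyElim, ?_⟩
    exact iff_of_true ⟨[], Set.mem_iInter.2 isEmptyElim⟩ ⟨Fin.elim0, isEmptyElim⟩
  have : NeZero n := ⟨hn.ne'⟩
  let sat (j : Fin m) (i : ℕ) (x : Bool) : Bool :=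
    decide (∃ k, (C j k).1.val = i ∧ (C j k).2 = x)
  have hlen (j : Fin m) (w : List Bool) (hw : w ∈ (positionDFA n (sat j)).accepts) :
      w.length = n := ((positionDFA.mem_accepts_iff w).1 hw).1
  refine ⟨fun _ => Option (Fin n × Bool), fun _ => inferInstance,
    fun j => positionDFA n (sat j), fun _ => ?_, hlen, fun j => ?_, ?_, ?_⟩
  · simp [mul_comm]
  · exact (List.finite_length_eq Bool n).subset (hlen j)
  · rintro ⟨w, hw⟩
    refine ⟨fun i => w[i.val]?.getD false, fun j => ?_⟩
    obtain ⟨-, i, x, hx, hs⟩ := (positionDFA.mem_accepts_iff w).1 (Set.mem_iInter.1 hw j)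
    obtain ⟨k, rfl, rfl⟩ := of_decide_eq_true hs
    exact ⟨k, by simp [hx]⟩
  · rintro ⟨σ, hσ⟩
    refine ⟨List.ofFn σ, Set.mem_iInter.2 fun j => (positionDFA.mem_accepts_iff _).2 ?_⟩
    obtain ⟨k, hk⟩ := hσ j
    exact ⟨List.length_ofFn, (C j k).1, (C j k).2, by simp [hk],
      decide_eq_true ⟨k, rfl, rfl⟩⟩
end

section
/- Let φ be a Boolean formula in 3-CNF with variables V_1, …, V_n and clauses C_1, …, C_m. Define a pattern p over the variables x_i, y_i (1 ≤ i ≤ n), z_j, u_j (1 ≤ j ≤ m), and v as follows. For 1 ≤ j ≤ m and 1 ≤ k ≤ 3, let f(j,k) = x_i if the k-th literal of C_j is V_i, and f(j,k) = y_i if the k-th literal of C_j is the negation of V_i. Let q_j = f(j,1) f(j,2) f(j,3) z_j, and set p = v^{2n+6m} · v x_1 y_1 v x_2 y_2 v ⋯ v x_n y_n v · q_1 v q_2 v ⋯ v q_m · v z_1 u_1 v z_2 u_2 ⋯ v z_m u_m v · v^{2n+6m}. Let w = 0^{2n+6m} (0 1^3)^n (0 1^7)^m (0 1^4)^m 0 0^{2n+6m},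 a word over {0,1}. Then the following are equivalent: (i) p matches some factor of w; (ii) p matches w; (iii) φ is satisfiable. -/
/-- The pattern alphabet with variables `x_i, y_i` (`i < n`), `z_j, u_j` (`j < m`)
and `v`. -/
def PatVar (n m : ℕ) : Type := (Fin n ⊕ Fin n) ⊕ ((Fin m ⊕ Fin m) ⊕ Unit)

/-- The variable `x_i`. -/
def varX {n m : ℕ} (i : Fin n) : PatVar n m := Sum.inl (Sum.inl i)

/-- The variable `y_i`. -/
def varY {n m : ℕ} (i : Fin n) : PatVar n m := Sum.inl (Sum.inr i)

/-- The variable `z_j`. -/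
def varZ {n m : ℕ} (j : Fin m) : PatVar n m := Sum.inr (Sum.inl (Sum.inl j))

/-- The variable `u_j`. -/
def varU {n m : ℕ} (j : Fin m) : PatVar n m := Sum.inr (Sum.inl (Sum.inr j))

/-- The variable `v`. -/
def varV {n m : ℕ} : PatVar n m := Sum.inr (Sum.inr ())

/-- `angluinF C j k` is `x_i` if the `k`-th literal of clause `C j` is the variable
`V_i`, and `y_i` if it is the negation of `V_i`.  (A clause is given as three
literals, each a pair of a variable index and a polarity.) -/
def angluinF {n m : ℕ} (C : Fin m → Fin 3 → Fin n × Bool) (j : Fin m) (k : Fin 3) :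
    PatVar n m :=
  if (C j k).2 then varX (C j k).1 else varY (C j k).1

/-- The word `q_j = f(j,1) f(j,2) f(j,3) z_j`. -/
def angluinQ {n m : ℕ} (C : Fin m → Fin 3 → Fin n × Bool) (j : Fin m) :
    List (PatVar n m) :=
  [angluinF C j 0, angluinF C j 1, angluinF C j 2, varZ j]

/-- The pattern
`p = v^{2n+6m} · v x₁y₁ v x₂y₂ ⋯ v xₙyₙ · v q₁ v q₂ ⋯ v qₘ · v z₁u₁ v z₂u₂ ⋯ v zₘuₘ · v · v^{2n+6m}`. -/
def angluinPattern {n m : ℕ} (C : Fin m → Fin 3 → Fin n × Bool) :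
    List (PatVar n m) :=
  List.replicate (2 * n + 6 * m) varV ++
  (List.ofFn fun i : Fin n => [varV, varX i, varY i]).flatten ++
  (List.ofFn fun j : Fin m => varV :: angluinQ C j).flatten ++
  (List.ofFn fun j : Fin m => [varV, varZ j, varU j]).flatten ++
  [varV] ++
  List.replicate (2 * n + 6 * m) varV

/-- The word `w = 0^{2n+6m} (01³)ⁿ (01⁷)ᵐ (01⁴)ᵐ 0 0^{2n+6m}` over `{0,1}`
(here `false` encodes `0` and `true` encodes `1`). -/
def angluinWord (n m : ℕ) : List Bool :=
  List.replicate (2 * n + 6 * m) false ++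
  (List.replicate n (false :: List.replicate 3 true)).flatten ++
  (List.replicate m (false :: List.replicate 7 true)).flatten ++
  (List.replicate m (false :: List.replicate 4 true)).flatten ++
  [false] ++
  List.replicate (2 * n + 6 * m) false

/-- The concatenation of the blocks `0 1^k`, for `k` in the given list. -/
def zeroBlocks (L : List ℕ) : List Bool :=
  (L.map fun k => false :: List.replicate k true).flatten

theorem zeroBlocks_cons (k : ℕ) (L : List ℕ) :
    zeroBlocks (k :: L) = false :: (List.replicate k true ++ zeroBlocks L) := by
  simp [zeroBlocks]

theorem zeroBlocks_append (L M : List ℕ) :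
    zeroBlocks (L ++ M) = zeroBlocks L ++ zeroBlocks M := by
  simp [zeroBlocks]

theorem zeroBlocks_replicate_zero (k : ℕ) :
    zeroBlocks (List.replicate k 0) = List.replicate k false := by
  induction k with
  | zero => rfl
  | succ k ih => simp [List.replicate_succ, zeroBlocks_cons, ih]

theorem replicate_true_append_zeroBlocks_inj {k l : ℕ} {L M : List ℕ}
    (h : List.replicate k true ++ zeroBlocks L = List.replicate l true ++ zeroBlocks M) :
    k = l ∧ zeroBlocks L = zeroBlocks M := by
  induction k generalizing l with
  | zero =>
    cases l with
    | zero => simpa using h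
    | succ l => cases L <;> simp [zeroBlocks, List.replicate_succ] at h
  | succ k ih =>
    cases l with
    | zero => cases M <;> simp [zeroBlocks, List.replicate_succ] at h
    | succ l =>
      simp only [List.replicate_succ, List.cons_append, List.cons.injEq, true_and] at h
      obtain ⟨rfl, hLM⟩ := ih h
      exact ⟨rfl, hLM⟩

theorem zeroBlocks_injective : Function.Injective zeroBlocks := by
  intro L
  induction L with
  | nil => intro M h; cases M <;> simp [zeroBlocks] at h ⊢
  | cons k L ih =>
    intro M h
    cases M with
    | nil => simp [zeroBlocks] at h
    | cons l M =>
      simp only [zeroBlocks_cons, List.cons.injEq, true_and] at h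
      obtain ⟨rfl, hLM⟩ := replicate_true_append_zeroBlocks_inj h
      rw [ih hLM]

theorem angluinWord_eq_zeroBlocks (n m : ℕ) :
    angluinWord n m = zeroBlocks (List.replicate (2 * n + 6 * m) 0 ++ List.replicate n 3 ++
      List.replicate m 7 ++ List.replicate m 4 ++ [0] ++ List.replicate (2 * n + 6 * m) 0) := by
  simp only [zeroBlocks_append, zeroBlocks_replicate_zero]
  simp [angluinWord, zeroBlocks]

/-- The image of the pattern under a morphism sending `v` to `0` and every other variable
to a power of `1`. -/
theorem flatten_map_angluinPattern {n m : ℕ} (C : Fin m → Fin 3 → Fin n × Bool)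
    {h : PatVar n m → List Bool} {l : PatVar n m → ℕ} (hv : h varV = [false])
    (hx : ∀ i, h (varX i) = List.replicate (l (varX i)) true)
    (hy : ∀ i, h (varY i) = List.replicate (l (varY i)) true)
    (hz : ∀ j, h (varZ j) = List.replicate (l (varZ j)) true)
    (hu : ∀ j, h (varU j) = List.replicate (l (varU j)) true) :
    ((angluinPattern C).map h).flatten = zeroBlocks (List.replicate (2 * n + 6 * m) 0 ++
      List.ofFn (fun i => l (varX i) + l (varY i)) ++
      List.ofFn (fun j => l (angluinF C j 0) + l (angluinF C j 1) + l (angluinF C j 2)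
        + l (varZ j)) ++
      List.ofFn (fun j => l (varZ j) + l (varU j)) ++ [0] ++
      List.replicate (2 * n + 6 * m) 0) := by
  have hf : ∀ j k, h (angluinF C j k) = List.replicate (l (angluinF C j k)) true := by
    intro j k
    unfold angluinF
    split_ifs
    · exact hx _
    · exact hy _
  simp only [zeroBlocks_append, zeroBlocks_replicate_zero]
  simp [angluinPattern, angluinQ, zeroBlocks, List.map_flatten, List.flatten_flatten,
    List.map_ofFn, Function.comp_def, hv, hx, hy, hz, hu, hf,
    add_assoc]

theorem flatten_map_angluinPattern_eq_iff {n m : ℕ} (C : Fin m → Fin 3 → Fin n × Bool)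
    {h : PatVar n m → List Bool} {l : PatVar n m → ℕ} (hv : h varV = [false])
    (hx : ∀ i, h (varX i) = List.replicate (l (varX i)) true)
    (hy : ∀ i, h (varY i) = List.replicate (l (varY i)) true)
    (hz : ∀ j, h (varZ j) = List.replicate (l (varZ j)) true)
    (hu : ∀ j, h (varU j) = List.replicate (l (varU j)) true) :
    ((angluinPattern C).map h).flatten = angluinWord n m ↔
      (∀ i, l (varX i) + l (varY i) = 3) ∧
      (∀ j, l (angluinF C j 0) + l (angluinF C j 1) + l (angluinF C j 2) + l (varZ j) = 7) ∧
      ∀ j, l (varZ j) + l (varU j) = 4 := by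
  rw [flatten_map_angluinPattern C hv hx hy hz hu, angluinWord_eq_zeroBlocks,
    zeroBlocks_injective.eq_iff]
  simp only [← List.ofFn_const, List.append_assoc]
  rw [List.append_cancel_left_eq, List.append_eq_append_iff_of_size_eq_left (by simp),
    List.append_eq_append_iff_of_size_eq_left (by simp),
    List.append_eq_append_iff_of_size_eq_left (by simp), eq_self, and_true]
  simp only [List.ofFn_inj, funext_iff]

theorem sum_map_angluinPattern {n m : ℕ} (C : Fin m → Fin 3 → Fin n × Bool)
    (g : PatVar n m → ℕ) :
    ((angluinPattern C).map g).sum = (5 * n + 14 * m + 1) * g varV +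
      ∑ i, (g (varX i) + g (varY i)) +
      ∑ j, (g (angluinF C j 0) + g (angluinF C j 1) + g (angluinF C j 2) + g (varZ j)) +
      ∑ j, (g (varZ j) + g (varU j)) := by
  simp only [angluinPattern, angluinQ, List.map_append, List.sum_append, List.map_flatten,
    List.map_ofFn, List.map_replicate, List.map_cons, List.map_nil, Function.comp_def,
    List.sum_flatten, List.sum_ofFn, List.sum_cons, List.sum_nil, List.sum_replicate,
    Finset.sum_add_distrib, Finset.sum_const, Finset.card_univ, Fintype.card_fin, smul_eq_mul]
  ring

theorem length_angluinWord (n m : ℕ) : (angluinWord n m).length = 8 * n + 25 * m + 1 := by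
  simp [angluinWord]
  ring

theorem count_true_angluinWord (n m : ℕ) :
    (angluinWord n m).count true = 3 * n + 11 * m := by
  simp [angluinWord, List.count_flatten, List.count_replicate]
  ring

theorem count_false_angluinWord (n m : ℕ) :
    (angluinWord n m).count false = 5 * n + 14 * m + 1 := by
  simp [angluinWord, List.count_flatten]
  ring

theorem eq_replicate_length_of_count_false_eq_zero {w : List Bool} (h : w.count false = 0) :
    w = List.replicate w.length true := by
  rw [List.eq_replicate_iff]
  refine ⟨rfl, fun b hb => ?_⟩
  cases b
  · exact absurd hb (List.count_eq_zero.1 h)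
  · rfl

theorem eq_nil_of_angluinWord_eq_append {n m : ℕ} {s u t : List Bool}
    (hw : angluinWord n m = s ++ u ++ t) (hs : s.count false = 0) (ht : t.count false = 0) :
    s = [] ∧ t = [] := by
  constructor
  · rcases s with _ | ⟨b, s⟩
    · rfl
    · cases b
      · simp at hs
      · cases hk : 2 * n + 6 * m with
        | zero =>
          obtain ⟨rfl, rfl⟩ : n = 0 ∧ m = 0 := by omega
          simp [angluinWord] at hw
        | succ k => simp [angluinWord, hk, List.replicate_succ] at hw
  · rcases List.eq_nil_or_concat t with rfl | ⟨t, b, rfl⟩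
    · rfl
    · cases b
      · simp at ht
      · have h := congrArg List.getLast? hw
        simp [angluinWord, List.getLast?_append, List.getLast?_replicate] at h
        grind

/-- A morphism matching the pattern with a factor of the word sends `v` to `0`. -/
theorem map_varV_of_factor {n m : ℕ} {C : Fin m → Fin 3 → Fin n × Bool}
    {h : PatVar n m → List Bool} (hne : ∀ a, h a ≠ []) {s t : List Bool}
    (hw : angluinWord n m = s ++ ((angluinPattern C).map h).flatten ++ t) :
    h varV = [false] := by
  have hpos : ∀ a, 1 ≤ (h a).length := fun a => List.length_pos_iff.2 (hne a)
  have hlen := congrArg List.length hw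
  simp only [length_angluinWord, List.length_append, List.length_flatten, List.map_map] at hlen
  rw [sum_map_angluinPattern] at hlen
  simp only [Function.comp_apply] at hlen
  have h1 : (h varV).length = 1 := by
    have hX := Finset.sum_le_sum fun (i : Fin n) (_ : i ∈ Finset.univ) =>
      add_le_add (hpos (varX i)) (hpos (varY i))
    have hQ := Finset.sum_le_sum fun (j : Fin m) (_ : j ∈ Finset.univ) =>
      add_le_add (add_le_add (add_le_add (hpos (angluinF C j 0)) (hpos (angluinF C j 1)))
        (hpos (angluinF C j 2))) (hpos (varZ j))
    simp only [Finset.sum_const, Finset.card_univ, Fintype.card_fin, smul_eq_mul] at hX hQ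
    have := hpos varV
    by_contra hne1
    have h2 : 2 ≤ (h varV).length := by omega
    have := Nat.mul_le_mul_left (5 * n + 14 * m + 1) h2
    omega
  obtain ⟨b, hb⟩ := List.length_eq_one_iff.1 h1
  cases b
  · exact hb
  · have hc := congrArg (List.count true) hw
    simp only [count_true_angluinWord, List.count_append, List.count_flatten,
      List.map_map] at hc
    rw [sum_map_angluinPattern] at hc
    simp [hb] at hc
    omega

theorem exists_assignment_of_factor {n m : ℕ} {C : Fin m → Fin 3 → Fin n × Bool}
    {h : PatVar n m → List Bool} (hne : ∀ a, h a ≠ []) {s t : List Bool}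
    (hw : angluinWord n m = s ++ ((angluinPattern C).map h).flatten ++ t) :
    ∃ σ : Fin n → Bool, ∀ j, ∃ k : Fin 3, σ (C j k).1 = (C j k).2 := by
  have hpos : ∀ a, 1 ≤ (h a).length := fun a => List.length_pos_iff.2 (hne a)
  have hv := map_varV_of_factor hne hw
  have hc := congrArg (List.count false) hw
  simp only [count_false_angluinWord, List.count_append, List.count_flatten,
    List.map_map] at hc
  rw [sum_map_angluinPattern] at hc
  simp only [Function.comp_apply, hv, List.count_singleton_self, mul_one] at hc
  obtain ⟨rfl, rfl⟩ := eq_nil_of_angluinWord_eq_append hw (by omega) (by omega)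
  have hX : ∑ i, ((h (varX i)).count false + (h (varY i)).count false) = 0 := by omega
  have hZ : ∑ j, ((h (varZ j)).count false + (h (varU j)).count false) = 0 := by omega
  simp only [Finset.sum_eq_zero_iff, Finset.mem_univ, true_implies, Nat.add_eq_zero_iff]
    at hX hZ
  rw [List.nil_append, List.append_nil, eq_comm,
    flatten_map_angluinPattern_eq_iff C (l := fun a => (h a).length) hv
      (fun i => eq_replicate_length_of_count_false_eq_zero (hX i).1)
      (fun i => eq_replicate_length_of_count_false_eq_zero (hX i).2)
      (fun j => eq_replicate_length_of_count_false_eq_zero (hZ j).1)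
      (fun j => eq_replicate_length_of_count_false_eq_zero (hZ j).2)] at hw
  obtain ⟨hxy, hq, hzu⟩ := hw
  have key : ∀ j k, 2 ≤ (h (angluinF C j k)).length →
      decide (2 ≤ (h (varX (C j k).1)).length) = (C j k).2 := by
    intro j k hk
    have := hxy (C j k).1
    unfold angluinF at hk
    split_ifs at hk with hb
    · simpa [hb] using hk
    · simp only [hb, decide_eq_false_iff_not]
      omega
  refine ⟨fun i => decide (2 ≤ (h (varX i)).length), fun j => ?_⟩
  by_contra! hcon
  have hlt : ∀ k, (h (angluinF C j k)).length < 2 := fun k =>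
    not_le.1 fun hk => hcon k (key j k hk)
  have := hlt 0
  have := hlt 1
  have := hlt 2
  have := hpos (varU j)
  have := hq j
  have := hzu j
  omega

/-- The exponent of the image of a variable under the morphism encoding an assignment, the images
of the `z_j` being given by `z`. -/
def assignmentLength {n m : ℕ} (σ : Fin n → Bool) (z : Fin m → ℕ) : PatVar n m → ℕ :=
  Sum.elim (Sum.elim (fun i => if σ i then 2 else 1) fun i => if σ i then 1 else 2)
    (Sum.elim (Sum.elim z fun j => 4 - z j) fun _ => 1)

theorem assignmentLength_angluinF {n m : ℕ} (C : Fin m → Fin 3 → Fin n × Bool)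
    (σ : Fin n → Bool) (z : Fin m → ℕ) (j : Fin m) (k : Fin 3) :
    assignmentLength σ z (angluinF C j k) = if σ (C j k).1 = (C j k).2 then 2 else 1 := by
  unfold angluinF
  cases hb : (C j k).2 <;> cases hs : σ (C j k).1 <;>
    simp [assignmentLength, varX, varY, hs]

theorem exists_match_of_assignment {n m : ℕ} {C : Fin m → Fin 3 → Fin n × Bool}
    {σ : Fin n → Bool} (hσ : ∀ j, ∃ k : Fin 3, σ (C j k).1 = (C j k).2) :
    ∃ h : PatVar n m → List Bool, (∀ a, h a ≠ []) ∧
      ((angluinPattern C).map h).flatten = angluinWord n m := by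
  let f : Fin m → Fin 3 → ℕ := fun j k => if σ (C j k).1 = (C j k).2 then 2 else 1
  let z : Fin m → ℕ := fun j => 7 - (f j 0 + f j 1 + f j 2)
  have hf : ∀ j k, 1 ≤ f j k ∧ f j k ≤ 2 := by
    intro j k
    simp only [f]
    split_ifs <;> simp
  have hsum : ∀ j, 4 ≤ f j 0 + f j 1 + f j 2 ∧ f j 0 + f j 1 + f j 2 ≤ 6 := by
    intro j
    obtain ⟨k, hk⟩ := hσ j
    have h2 : f j k = 2 := if_pos hk
    have := hf j 0
    have := hf j 1
    have := hf j 2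
    fin_cases k <;> simp at h2 <;> omega
  have hz : ∀ j, 1 ≤ z j ∧ z j ≤ 3 := by
    intro j
    have := hsum j
    simp only [z]
    omega
  have hpos : ∀ a, assignmentLength σ z a ≠ 0 := by
    rintro ((i | i) | ((j | j) | _)) <;> simp only [assignmentLength, Sum.elim_inl, Sum.elim_inr]
    · split_ifs <;> simp
    · split_ifs <;> simp
    · have := hz j
      omega
    · have := hz j
      omega
    · simp
  refine ⟨fun a => List.replicate (assignmentLength σ z a)
    (Sum.elim (fun _ => true) (Sum.elim (fun _ => true) fun _ => false) a), fun a => by simpa using hpos a, ?_⟩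
  rw [flatten_map_angluinPattern_eq_iff C (l := assignmentLength σ z) rfl (fun _ => rfl)
    (fun _ => rfl) (fun _ => rfl) (fun _ => rfl)]
  simp only [assignmentLength_angluinF]
  refine ⟨fun i => ?_, fun j => ?_, fun j => ?_⟩
  · simp only [assignmentLength, varX, varY, Sum.elim_inl, Sum.elim_inr]
    split_ifs <;> rfl
  · have := hsum j
    change f j 0 + f j 1 + f j 2 + (7 - (f j 0 + f j 1 + f j 2)) = 7
    omega
  · have := hz j
    change z j + (4 - z j) = 4
    omega

/-- For a 3-CNF formula with `n` variables and `m` clauses, the following are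
equivalent: (i) the pattern `p` matches some factor of `w`; (ii) `p` matches `w`;
(iii) the formula is satisfiable.  Here a pattern matches a word when some
non-erasing morphism (given by its values `h` on letters) sends it to the word. -/
theorem angluin_pattern_reduction (n m : ℕ) (C : Fin m → Fin 3 → Fin n × Bool) :
    ((∃ h : PatVar n m → List Bool, (∀ a, h a ≠ []) ∧
        ∃ s t : List Bool,
          angluinWord n m = s ++ ((angluinPattern C).map h).flatten ++ t) ↔
      ∃ σ : Fin n → Bool, ∀ j, ∃ k : Fin 3, σ (C j k).1 = (C j k).2) ∧
    ((∃ h : PatVar n m → List Bool, (∀ a, h a ≠ []) ∧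
        ((angluinPattern C).map h).flatten = angluinWord n m) ↔
      ∃ σ : Fin n → Bool, ∀ j, ∃ k : Fin 3, σ (C j k).1 = (C j k).2) := by
  have of_assignment : (∃ σ : Fin n → Bool, ∀ j, ∃ k : Fin 3, σ (C j k).1 = (C j k).2) →
      ∃ h : PatVar n m → List Bool, (∀ a, h a ≠ []) ∧
        ((angluinPattern C).map h).flatten = angluinWord n m :=
    fun ⟨_, hσ⟩ => exists_match_of_assignment hσ
  refine ⟨⟨fun ⟨h, hne, s, t, hw⟩ => exists_assignment_of_factor hne hw, fun hσ => ?_⟩,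
    ⟨fun ⟨h, hne, hw⟩ => ?_, of_assignment⟩⟩
  · obtain ⟨h, hne, hw⟩ := of_assignment hσ
    exact ⟨h, hne, [], [], by simp [hw]⟩
  · exact exists_assignment_of_factor (s := []) (t := []) hne (by simp [hw])
end

section
/- Let Σ be an alphabet, let n ≥ 1, and let (x_1, y_1), …, (x_n, y_n) be pairs of nonempty words over Σ. Let #, c_1, …, c_n be n+1 distinct symbols not in Σ. Define L to be the language of all words of the form x_{i_1} x_{i_2} ⋯ x_{i_k} c_{i_k} ⋯ c_{i_2} c_{i_1} # y_{j_1} y_{j_2} ⋯ y_{j_l} c_{j_l} ⋯ c_{j_2} c_{j_1} # where k, l ≥ 1 and each i_a, j_b ∈ {1, …, n}. Then L contains a square (a word of the form u u with u nonempty) if and only if there exist k ≥ 1 and indices i_1, …, i_k ∈ {1, …, n} with x_{i_1} x_{i_2} ⋯ x_{i_k} = y_{i_1} y_{i_2} ⋯ y_{i_k}. -/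
/-- The extended alphabet `Σ ⊕ {#, c_1, …, c_n}` used in the PCP reduction. -/
def PCPAlph (σ : Type*) (n : ℕ) : Type _ := σ ⊕ (Unit ⊕ Fin n)

/-- The marker symbol `#`. -/
def pcpHash {σ : Type*} {n : ℕ} : PCPAlph σ n := Sum.inr (Sum.inl ())

/-- The symbol `c_i`. -/
def pcpC {σ : Type*} {n : ℕ} (i : Fin n) : PCPAlph σ n := Sum.inr (Sum.inr i)

/-- Embedding of words over `Σ` into words over the extended alphabet. -/
def pcpEmb {σ : Type*} {n : ℕ} (w : List σ) : List (PCPAlph σ n) :=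
  w.map Sum.inl

/-- The encoding `x_{i₁} x_{i₂} ⋯ x_{i_k} c_{i_k} ⋯ c_{i₂} c_{i₁}` of a nonempty
index sequence `is = [i₁, …, i_k]`. -/
def pcpEnc {σ : Type*} {n : ℕ} (x : Fin n → List σ) (is : List (Fin n)) :
    List (PCPAlph σ n) :=
  (is.map fun i => pcpEmb (x i)).flatten ++ (is.map pcpC).reverse

theorem List.eq_of_append_marker_append_marker_eq_append_self {α : Type*} {a : α}
    {s t v : List α} (hs : a ∉ s) (ht : a ∉ t) (hv : v ≠ [])
    (h : s ++ [a] ++ t ++ [a] = v ++ v) : s = t := by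
  obtain ⟨w, b, rfl⟩ : ∃ w b, v = w ++ [b] :=
    ⟨v.dropLast, v.getLast hv, (List.dropLast_append_getLast hv).symm⟩
  rw [← List.append_assoc (w ++ [b]) w [b]] at h
  obtain ⟨h, hab⟩ := List.append_inj' h rfl
  obtain rfl : a = b := by simpa using hab
  simp only [List.append_assoc, List.singleton_append] at h
  obtain ⟨h₁, -, h₂⟩ := (List.append_cons_inj_of_notMem hs ht).mp h
  exact h₁.trans h₂.symm

theorem pcpEnc_eq {σ : Type*} {n : ℕ} (x : Fin n → List σ) (is : List (Fin n)) :
    pcpEnc x is = pcpEmb (is.map x).flatten ++ is.reverse.map pcpC := by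
  rw [pcpEnc, List.map_reverse]
  congr 1
  exact (List.map_map (f := x) (g := pcpEmb) (l := is) ▸ List.map_flatten ..).symm

theorem pcpHash_notMem_pcpEnc {σ : Type*} {n : ℕ} (x : Fin n → List σ) (is : List (Fin n)) :
    pcpHash ∉ pcpEnc x is := by
  rw [pcpEnc_eq, List.mem_append]
  rintro (h | h)
  · obtain ⟨_, -, h⟩ := List.mem_map.mp h
    exact Sum.inl_ne_inr h
  · obtain ⟨_, -, h⟩ := List.mem_map.mp h
    exact Sum.inr_ne_inl (Sum.inr_injective h)

/-- The letter of `Σ` represented by a symbol of the extended alphabet, if any. -/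
def pcpLetter {σ : Type*} {n : ℕ} (s : PCPAlph σ n) : Option σ :=
  Sum.getLeft? s

/-- The index `i` of a symbol `c_i` of the extended alphabet. -/
def pcpIndex {σ : Type*} {n : ℕ} (s : PCPAlph σ n) : Option (Fin n) :=
  (Sum.getRight? s).bind Sum.getRight?

theorem filterMap_pcpLetter {σ : Type*} {n : ℕ} (w : List σ) (is : List (Fin n)) :
    (pcpEmb w ++ is.map pcpC).filterMap pcpLetter = w := by
  have h₁ : pcpLetter (n := n) ∘ Sum.inl = (some : σ → Option σ) := rfl
  have h₂ : pcpLetter (σ := σ) ∘ pcpC (n := n) = fun _ => none := rfl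
  rw [List.filterMap_append, pcpEmb]
  erw [List.filterMap_map, List.filterMap_map]
  rw [h₁, h₂]
  simp

theorem filterMap_pcpIndex {σ : Type*} {n : ℕ} (w : List σ) (is : List (Fin n)) :
    (pcpEmb w ++ is.map pcpC).filterMap pcpIndex = is := by
  have h₁ : pcpIndex (n := n) ∘ Sum.inl = fun _ : σ => none := rfl
  have h₂ : pcpIndex (σ := σ) ∘ pcpC (n := n) = some := rfl
  rw [List.filterMap_append, pcpEmb]
  erw [List.filterMap_map, List.filterMap_map]
  rw [h₁, h₂]
  simp

theorem pcpEnc_inj {σ : Type*} {n : ℕ} {x y : Fin n → List σ} {is js : List (Fin n)} :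
    pcpEnc x is = pcpEnc y js ↔ is = js ∧ (is.map x).flatten = (js.map y).flatten := by
  rw [pcpEnc_eq, pcpEnc_eq]
  constructor
  · intro h
    have hl := congrArg (List.filterMap pcpLetter) h
    have hr := congrArg (List.filterMap pcpIndex) h
    rw [filterMap_pcpLetter, filterMap_pcpLetter] at hl
    rw [filterMap_pcpIndex, filterMap_pcpIndex] at hr
    exact ⟨List.reverse_injective hr, hl⟩
  · rintro ⟨rfl, h⟩
    rw [h]

/-- The language `L` of all words
`x_{i₁} ⋯ x_{i_k} c_{i_k} ⋯ c_{i₁} # y_{j₁} ⋯ y_{j_l} c_{j_l} ⋯ c_{j₁} #`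
with `k, l ≥ 1`.  It contains a square `u u` (with `u` nonempty) iff the PCP
instance `(x_1,y_1), …, (x_n,y_n)` has a solution. -/
theorem pcp_square_reduction {σ : Type*} (n : ℕ) (hn : 1 ≤ n)
    (x y : Fin n → List σ) (hx : ∀ i, x i ≠ []) (hy : ∀ i, y i ≠ []) :
    (∃ u ∈ {u : List (PCPAlph σ n) | ∃ is js : List (Fin n), is ≠ [] ∧ js ≠ [] ∧
        u = pcpEnc x is ++ [pcpHash] ++ pcpEnc y js ++ [pcpHash]},
      ∃ v : List (PCPAlph σ n), v ≠ [] ∧ u = v ++ v) ↔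
    ∃ is : List (Fin n), is ≠ [] ∧ (is.map x).flatten = (is.map y).flatten := by
  constructor
  · rintro ⟨_, ⟨is, js, his, -, rfl⟩, v, hv, h⟩
    obtain ⟨rfl, hxy⟩ := pcpEnc_inj.mp
      (List.eq_of_append_marker_append_marker_eq_append_self (pcpHash_notMem_pcpEnc x is)
        (pcpHash_notMem_pcpEnc y js) hv h)
    exact ⟨is, his, hxy⟩
  · rintro ⟨is, his, hxy⟩
    refine ⟨_, ⟨is, is, his, his, rfl⟩, pcpEnc x is ++ [pcpHash], by simp, ?_⟩
    rw [← pcpEnc_inj.mpr ⟨rfl, hxy⟩, List.append_assoc _ (pcpEnc x is)]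
end
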